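/- Let k ≥ 2 and let P be a partition of {0,1,…,n} whose colored arc diagram has no black k-crossing. Suppose a is a red node under a black (k−1)-crossing, and let (i_1,j_1),(i_2,j_2),…,(i_{k−1},j_{k−1}) be an innermost black (k−1)-crossing covering a, i.e. one for which the word (j_1,j_2,…,j_{k−1}) is lexicographically smallest among black (k−1)-crossings with i_{k−1} < a < j_1. Then the set of arcs obtained from the arc diagram of P by replacing the arcs (i_1,j_1),…,(i_{k−1},j_{k−1}) with the arcs (i_1,a),(i_2,j_1),…,(i_{k−1},j_{k−2}),(a,j_{k−1}) (all colored black, the node a being recolored black and removed from the red block, all other arcs and colors unchanged) contains no set of k black arcs forming a k-crossing. -/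

import Mathlib

open Finset Polynomial

/-- `(i,j)` with `i < j` is an arc of the arc diagram of `P`: `i` and `j` lie in a common
block `B` and no element of `B` is strictly between them. -/
def IsArc {s : Finset ℕ} (P : Finpartition s) (i j : ℕ) : Prop :=
  i < j ∧ ∃ B ∈ P.parts, i ∈ B ∧ j ∈ B ∧ ∀ l ∈ B, ¬(i < l ∧ l < j)

/-- `(i,j)` is an arc or a loop (`i = j` and `{i}` a singleton block) of the arc diagram. -/
def IsDiagArc {s : Finset ℕ} (P : Finpartition s) (i j : ℕ) : Prop :=
  IsArc P i j ∨ (i = j ∧ {i} ∈ P.parts)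

/-- `P` has a `k`-crossing: arcs `(i₁,j₁),…,(i_k,j_k)` with `i₁<⋯<i_k<j₁<⋯<j_k`. -/
def HasKCrossing {s : Finset ℕ} (P : Finpartition s) (k : ℕ) : Prop :=
  ∃ f g : Fin k → ℕ,
    StrictMono f ∧ StrictMono g ∧ (∀ m, IsDiagArc P (f m) (g m)) ∧
    ∀ a b : Fin k, f a < g b

/-- `P` has a weak `k`-crossing: arcs `(i₁,j₁),…,(i_k,j_k)` with
`i₁<⋯<i_k = j₁<⋯<j_k` (the largest left endpoint equals the smallest right endpoint). -/
def HasWeakKCrossing {s : Finset ℕ} (P : Finpartition s) (k : ℕ) : Prop :=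
  ∃ f g : Fin k → ℕ,
    StrictMono f ∧ StrictMono g ∧ (∀ m, IsDiagArc P (f m) (g m)) ∧
    ∃ a b : Fin k, f a = g b ∧ (∀ c, f c ≤ f a) ∧ (∀ c, g b ≤ g c)

/-- `P` has an enhanced `k`-crossing: a `k`-crossing or a weak `k`-crossing. -/
def HasEnhancedKCrossing {s : Finset ℕ} (P : Finpartition s) (k : ℕ) : Prop :=
  HasKCrossing P k ∨ HasWeakKCrossing P k

open scoped Classical in
/-- The generating polynomial `∑ t^{number of blocks}` over the partitions of `s`
satisfying the predicate `pr`. -/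
noncomputable def partPoly (s : Finset ℕ) (pr : Finpartition s → Prop) : Polynomial ℤ :=
  ∑ P : Finpartition s, if pr P then (X : Polynomial ℤ) ^ P.parts.card else 0


/-- `i` is a red node of `P`: it lies in the block containing `0` (the red block). -/
def IsRed {s : Finset ℕ} (P : Finpartition s) (i : ℕ) : Prop :=
  ∃ B ∈ P.parts, 0 ∈ B ∧ i ∈ B

/-- `(i,j)` is a black arc: an arc of the diagram which is not between two red nodes. -/
def IsBlackArc {s : Finset ℕ} (P : Finpartition s) (i j : ℕ) : Prop :=
  IsDiagArc P i j ∧ ¬ (IsRed P i ∧ IsRed P j)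

/-- The set of black arcs of the colored arc diagram of `P`. -/
def BlackArcSet {s : Finset ℕ} (P : Finpartition s) : Set (ℕ × ℕ) :=
  {p | IsBlackArc P p.1 p.2}

/-- A set `A` of arcs contains `k` arcs forming a `k`-crossing:
arcs `(i₁,j₁),…,(i_k,j_k) ∈ A` with `i₁<⋯<i_k<j₁<⋯<j_k`. -/
def SetHasKCrossing (A : Set (ℕ × ℕ)) (k : ℕ) : Prop :=
  ∃ f : Fin k → ℕ × ℕ, (∀ m, f m ∈ A) ∧ StrictMono (fun m => (f m).1) ∧
    StrictMono (fun m => (f m).2) ∧ ∀ a b : Fin k, (f a).1 < (f b).2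

/-- Strict lexicographic order on words `Fin m → ℕ`. -/
def LexLt {m : ℕ} (u v : Fin m → ℕ) : Prop :=
  ∃ i : Fin m, (∀ j : Fin m, j < i → u j = v j) ∧ u i < v i

section Chains

variable {T : Type*} [LinearOrder T]

/-- There is a chain of `t` pairs satisfying `R`, increasing in both coordinates, whose
coordinates are all below `p` and `q` respectively. -/
def ChainBelow (R : T → T → Prop) : ℕ → T → T → Prop
  | 0, _, _ => True
  | t + 1, p, q => ∃ p' q', R p' q' ∧ p' < p ∧ q' < q ∧ ChainBelow R t p' q'

theorem ChainBelow.exists_strictMono {R : T → T → Prop} (t : ℕ) (p q : T) (hR : R p q)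
    (h : ChainBelow R t p q) :
    ∃ f g : ℕ → T, f t = p ∧ g t = q ∧ (∀ l ≤ t, R (f l) (g l)) ∧
      ∀ l l', l < l' → l' ≤ t → f l < f l' ∧ g l < g l' := by
  induction t generalizing p q with
  | zero =>
    refine ⟨fun _ => p, fun _ => q, rfl, rfl, fun _ _ => hR, fun l l' h₁ h₂ => ?_⟩
    omega
  | succ t ih =>
    obtain ⟨p', q', hR', hp, hq, hc⟩ := h
    obtain ⟨f, g, hf, hg, hfg, hm⟩ := ih p' q' hR' hc
    refine ⟨Function.update f (t + 1) p, Function.update g (t + 1) q, by simp, by simp,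
      fun l hl => ?_, fun l l' h₁ h₂ => ?_⟩
    · rcases eq_or_lt_of_le hl with rfl | hl
      · simpa using hR
      · simpa [Function.update_of_ne hl.ne] using hfg l (by omega)
    · have hl : l ≠ t + 1 := by omega
      rw [Function.update_of_ne hl, Function.update_of_ne hl]
      rcases eq_or_lt_of_le h₂ with rfl | h₂
      · have hle : f l ≤ p' ∧ g l ≤ q' := by
          rcases eq_or_lt_of_le (Nat.lt_succ_iff.mp h₁) with rfl | h₁
          · exact ⟨hf.le, hg.le⟩
          · have := hm l t h₁ le_rfl
            exact ⟨hf ▸ this.1.le, hg ▸ this.2.le⟩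
        simpa using ⟨hle.1.trans_lt hp, hle.2.trans_lt hq⟩
      · rw [Function.update_of_ne h₂.ne, Function.update_of_ne h₂.ne]
        exact hm l l' h₁ (by omega)

/-- `I`, `J` describe a chain `(I l, J l)`, `1 ≤ l < k`, of arcs of `B` covering `a`
(with `J 0 = I k = a`), such that no other such chain is nested in it with a strictly
nested member. -/
structure IsInnermostChain (k : ℕ) (B : T → T → Prop) (a : T) (I J : ℕ → T) : Prop where
  J_zero : J 0 = a
  I_last : I k = a
  I_lt : ∀ l l', 1 ≤ l → l < l' → l' ≤ k → I l < I l'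
  J_lt : ∀ l l', l < l' → l' < k → J l < J l'
  mem : ∀ l, 1 ≤ l → l < k → B (I l) (J l)
  innermost : ∀ i j : ℕ → T,
    (∀ l, 1 ≤ l → l < k → B (i l) (j l) ∧ I l ≤ i l ∧ i l < a ∧ a < j l ∧ j l ≤ J l) →
    (∀ l l', 1 ≤ l → l < l' → l' < k → i l < i l' ∧ j l < j l') →
    ∀ l, 1 ≤ l → l < k → ¬ (I l < i l ∧ j l < J l)

namespace IsInnermostChain

variable {k : ℕ} {B : T → T → Prop} {a : T} {I J : ℕ → T}

theorem I_lt_base (h : IsInnermostChain k B a I J) {l : ℕ} (h₁ : 1 ≤ l) (h₂ : l < k) :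
    I l < a := h.I_last ▸ h.I_lt l k h₁ h₂ le_rfl

theorem base_lt_J (h : IsInnermostChain k B a I J) {l : ℕ} (h₁ : 1 ≤ l) (h₂ : l < k) :
    a < J l := h.J_zero ▸ h.J_lt 0 l h₁ h₂

/-- A chain below `(p, q)` can be moved below `(I c, J c)`, provided that `(I l, J l)`, `c < l`,
can be replaced by arcs nested in them and lying above `(p, q)`. -/
theorem chainBelow_of_tail (h : IsInnermostChain k B a I J)
    (huniq : ∀ p q q', B p q → B p q' → p < q → p < q' → q = q')
    {x : T} (hx : a ≤ x) (t c : ℕ) (p q : T) (hc : 1 ≤ c) (hck : c < k) (hpa : p ≤ a)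
    (hq : q ≤ J c) (i j : ℕ → T) (hhead : ∀ l ≤ c, i l = I l ∧ j l = J l)
    (htail : ∀ l, c < l → l < k →
      B (i l) (j l) ∧ I l ≤ i l ∧ i l < a ∧ a < j l ∧ j l ≤ J l ∧ p ≤ i l ∧ q ≤ j l)
    (hmono : ∀ l l', c < l → l < l' → l' < k → i l < i l' ∧ j l < j l')
    (hch : ChainBelow (fun p q => B p q ∧ p ≤ x ∧ x < q) t p q) :
    ChainBelow (fun p q => B p q ∧ p ≤ x ∧ x < q) t (I c) (J c) := by
  induction t generalizing c p q i j with
  | zero => trivial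
  | succ t ih =>
    obtain ⟨p', q', ⟨hB, hpx, hxq⟩, hp', hq', hch'⟩ := hch
    rcases le_or_gt p' (I c) with hpI | hpI
    · rcases eq_or_lt_of_le hpI with rfl | hpI
      · have := huniq _ _ _ hB (h.mem c hc hck) (hpx.trans_lt hxq)
          ((h.I_lt_base hc hck).trans (h.base_lt_J hc hck))
        exact absurd this (hq'.trans_le hq).ne
      · exact ⟨p', q', ⟨hB, hpx, hxq⟩, hpI, hq'.trans_le hq, hch'⟩
    · have hqJ : q' < J c := hq'.trans_le hq
      have haq : a < q' := hx.trans_lt hxq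
      have hpa' : p' < a := hp'.trans_le hpa
      set i' := Function.update i c p'
      set j' := Function.update j c q'
      have hic : i' c = p' := by simp [i']
      have hjc : j' c = q' := by simp [j']
      have hne : ∀ l, l ≠ c → i' l = i l ∧ j' l = j l := fun l hl => by
        simp [i', j', hl]
      have hlow : ∀ l ≤ c - 1, i' l = I l ∧ j' l = J l := fun l hl => by
        have hl' := hne l (by omega)
        have := hhead l (by omega)
        exact ⟨hl'.1.trans this.1, hl'.2.trans this.2⟩
      have htail' : ∀ l, c - 1 < l → l < k → B (i' l) (j' l) ∧ I l ≤ i' l ∧ i' l < a ∧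
          a < j' l ∧ j' l ≤ J l ∧ p' ≤ i' l ∧ q' ≤ j' l := by
        intro l h₁ h₂
        rcases eq_or_ne l c with rfl | hl
        · rw [hic, hjc]
          exact ⟨hB, hpI.le, hpa', haq, hqJ.le, le_rfl, le_rfl⟩
        · rw [(hne l hl).1, (hne l hl).2]
          obtain ⟨b1, b2, b3, b4, b5, b6, b7⟩ := htail l (by omega) h₂
          exact ⟨b1, b2, b3, b4, b5, hp'.le.trans b6, hq'.le.trans b7⟩
      have hmono' : ∀ l l', c - 1 < l → l < l' → l' < k → i' l < i' l' ∧ j' l < j' l' := by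
        intro l l' h₁ h₂ h₃
        have hl' := hne l' (by omega)
        rw [hl'.1, hl'.2]
        rcases eq_or_ne l c with rfl | hl
        · rw [hic, hjc]
          obtain ⟨-, -, -, -, -, b6, b7⟩ := htail l' h₂ h₃
          exact ⟨hp'.trans_le b6, hq'.trans_le b7⟩
        · rw [(hne l hl).1, (hne l hl).2]
          exact hmono l l' (by omega) h₂ h₃
      have hqc : q' ≤ J (c - 1) := by
        by_contra! hlt
        refine h.innermost i' j' (fun l h₁ h₂ => ?_) (fun l l' h₁ h₂ h₃ => ?_) c hc hck
          ⟨hic ▸ hpI, hjc ▸ hqJ⟩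
        · rcases Nat.lt_or_ge (c - 1) l with hl | hl
          · obtain ⟨b1, b2, b3, b4, b5, -, -⟩ := htail' l hl h₂
            exact ⟨b1, b2, b3, b4, b5⟩
          · rw [(hlow l hl).1, (hlow l hl).2]
            exact ⟨h.mem l h₁ h₂, le_rfl, h.I_lt_base h₁ h₂, h.base_lt_J h₁ h₂, le_rfl⟩
        · rcases Nat.lt_or_ge (c - 1) l with hl | hl
          · exact hmono' l l' hl h₂ h₃
          · rw [(hlow l hl).1, (hlow l hl).2]
            rcases Nat.lt_or_ge (c - 1) l' with hl' | hl'
            · obtain ⟨-, b2, -, -, -, -, b7⟩ := htail' l' hl' h₃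
              refine ⟨(h.I_lt l l' h₁ h₂ h₃.le).trans_le b2, lt_of_le_of_lt ?_ (hlt.trans_le b7)⟩
              rcases eq_or_lt_of_le hl with rfl | hl
              · exact le_rfl
              · exact (h.J_lt l (c - 1) hl (by omega)).le
            · rw [(hlow l' hl').1, (hlow l' hl').2]
              exact ⟨h.I_lt l l' h₁ h₂ h₃.le, h.J_lt l l' h₂ h₃⟩
      have hc1 : 1 ≤ c - 1 := by
        by_contra hc0
        have hc0 : c - 1 = 0 := by omega
        rw [hc0, h.J_zero] at hqc
        exact absurd hqc haq.not_ge
      have hck1 : c - 1 < k := by omega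
      refine ⟨I (c - 1), J (c - 1), ⟨h.mem _ hc1 hck1, (h.I_lt_base hc1 hck1).le.trans hx,
        hxq.trans_le hqc⟩, h.I_lt _ _ hc1 (by omega) hck.le, h.J_lt _ _ (by omega) hck, ?_⟩
      exact ih (c - 1) p' q' hc1 hck1 hpa'.le hqc i' j' hlow htail' hmono' hch'

/-- A chain through a point `x ≥ a` that uses arcs of `B` and shifted arcs `(I m, J (m - 1))`
can be replaced by a chain of `B` of the same length. -/
theorem exists_chain_of_shifted (h : IsInnermostChain k B a I J)
    (huniq : ∀ p q q', B p q → B p q' → p < q → p < q' → q = q')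
    {x : T} (hx : a ≤ x) (hk : 1 ≤ k) (f g : ℕ → T)
    (hf : ∀ l < k, f l ≤ x ∧ x < g l)
    (hmem : ∀ l < k, B (f l) (g l) ∨
      ∃ m, 1 ≤ m ∧ m ≤ k ∧ f l = I m ∧ g l = J (m - 1))
    (hmono : ∀ l l', l < l' → l' < k → f l < f l' ∧ g l < g l') :
    ∃ f' g' : ℕ → T, (∀ l < k, B (f' l) (g' l) ∧ f' l ≤ x ∧ x < g' l) ∧
      ∀ l l', l < l' → l' < k → f' l < f' l' ∧ g' l < g' l' := by
  set R : T → T → Prop := fun p q => B p q ∧ p ≤ x ∧ x < q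
  have step : ∀ l < k, ∀ t, ChainBelow R t (f l) (g l) →
      ∃ p q, R p q ∧ p ≤ f l ∧ q ≤ g l ∧ ChainBelow R t p q := by
    intro l hl t hch
    rcases hmem l hl with hB | ⟨m, hm1, hmk, hfl, hgl⟩
    · exact ⟨_, _, ⟨hB, hf l hl⟩, le_rfl, le_rfl, hch⟩
    · have hxJ : x < J (m - 1) := hgl ▸ (hf l hl).2
      have hm2 : 1 ≤ m - 1 := by
        by_contra hm0
        have hm0 : m - 1 = 0 := by omega
        rw [hm0, h.J_zero] at hxJ
        exact absurd hx hxJ.not_ge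
      have hmk' : m - 1 < k := by omega
      have hIa : I m ≤ a := by
        rcases eq_or_lt_of_le hmk with rfl | hmk
        · exact h.I_last.le
        · exact (h.I_lt_base hm1 hmk).le
      rw [hfl, hgl] at hch ⊢
      refine ⟨I (m - 1), J (m - 1), ⟨h.mem _ hm2 hmk', (h.I_lt_base hm2 hmk').le.trans hx, hxJ⟩,
        (h.I_lt _ _ hm2 (by omega) hmk).le, le_rfl, ?_⟩
      refine h.chainBelow_of_tail huniq hx t (m - 1) (I m) (J (m - 1)) hm2 hmk' hIa le_rfl I J
        (fun _ _ => ⟨rfl, rfl⟩) (fun l h₁ h₂ => ?_) (fun l l' h₁ h₂ h₃ => ?_) hch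
      · have hl1 : 1 ≤ l := by omega
        refine ⟨h.mem l hl1 h₂, le_rfl, h.I_lt_base hl1 h₂, h.base_lt_J hl1 h₂, le_rfl, ?_,
          (h.J_lt _ _ h₁ h₂).le⟩
        rcases eq_or_lt_of_le (show m ≤ l by omega) with rfl | hml
        · exact le_rfl
        · exact (h.I_lt _ _ hm1 hml h₂.le).le
      · exact ⟨h.I_lt l l' (by omega) h₂ h₃.le, h.J_lt l l' h₂ h₃⟩
  have hall : ∀ l < k, ChainBelow R l (f l) (g l) := by
    intro l
    induction l with
    | zero => exact fun _ => trivial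
    | succ l ih =>
      intro hl
      obtain ⟨p, q, hpq, hp, hq, hch⟩ := step l (by omega) l (ih (by omega))
      have := hmono l (l + 1) (by omega) hl
      exact ⟨p, q, hpq, hp.trans_lt this.1, hq.trans_lt this.2, hch⟩
  obtain ⟨p, q, hpq, -, -, hch⟩ := step (k - 1) (by omega) _ (hall (k - 1) (by omega))
  obtain ⟨f', g', -, -, hR', hm'⟩ := ChainBelow.exists_strictMono _ p q hpq hch
  exact ⟨f', g', fun l hl => hR' l (by omega), fun l l' h₁ h₂ => hm' l l' h₁ (by omega)⟩

/-- Reversing the order of the nodes reverses an innermost chain. -/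
theorem dual (h : IsInnermostChain k B a I J) :
    IsInnermostChain (T := Tᵒᵈ) k
      (fun p q => B (OrderDual.ofDual q) (OrderDual.ofDual p)) (OrderDual.toDual a)
      (fun l => OrderDual.toDual (J (k - l))) (fun l => OrderDual.toDual (I (k - l))) where
  J_zero := by simp [h.I_last]
  I_last := by simp [h.J_zero]
  I_lt l l' h₁ h₂ h₃ := OrderDual.toDual_lt_toDual.mpr (h.J_lt _ _ (by omega) (by omega))
  J_lt l l' h₁ h₂ :=
    OrderDual.toDual_lt_toDual.mpr (h.I_lt _ _ (by omega) (by omega) (by omega))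
  mem l h₁ h₂ := h.mem _ (by omega) (by omega)
  innermost i j hij hm l h₁ h₂ hlt := by
    refine h.innermost (fun l => OrderDual.ofDual (j (k - l)))
      (fun l => OrderDual.ofDual (i (k - l))) (fun l h₁ h₂ => ?_) (fun l l' h₁ h₂ h₃ => ?_)
      (k - l) (by omega) (by omega) ?_
    · obtain ⟨b1, b2, b3, b4, b5⟩ := hij (k - l) (by omega) (by omega)
      have hkl : k - (k - l) = l := by omega
      rw [hkl] at b2 b5
      exact ⟨b1, b5, b4, b3, b2⟩
    · obtain ⟨b1, b2⟩ := hm (k - l') (k - l) (by omega) (by omega) (by omega)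
      exact ⟨b2, b1⟩
    · have hkl : k - (k - l) = l := by omega
      simp only [hkl]
      exact ⟨hlt.2, hlt.1⟩

/-- If `B` together with the shifted arcs `(I m, J (m - 1))` contains a `k`-crossing, then so
does `B`. -/
theorem exists_crossing_of_shifted (h : IsInnermostChain k B a I J)
    (hleft : ∀ p q q', B p q → B p q' → p < q → p < q' → q = q')
    (hright : ∀ p p' q, B p q → B p' q → p < q → p' < q → p = p')
    (hk : 1 ≤ k) (f g : ℕ → T)
    (hcross : ∀ l < k, ∀ l' < k, f l < g l')
    (hmem : ∀ l < k, B (f l) (g l) ∨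
      ∃ m, 1 ≤ m ∧ m ≤ k ∧ f l = I m ∧ g l = J (m - 1))
    (hmono : ∀ l l', l < l' → l' < k → f l < f l' ∧ g l < g l') :
    ∃ f' g' : ℕ → T, (∀ l < k, B (f' l) (g' l)) ∧ (∀ l < k, ∀ l' < k, f' l < g' l') ∧
      ∀ l l', l < l' → l' < k → f' l < f' l' ∧ g' l < g' l' := by
  have hg0 : ∀ l < k, g 0 ≤ g l := fun l hl => by
    rcases Nat.eq_zero_or_pos l with rfl | h0
    · exact le_rfl
    · exact (hmono 0 l h0 hl).2.le
  have hfk : ∀ l < k, f l ≤ f (k - 1) := fun l hl => by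
    rcases eq_or_lt_of_le (show l ≤ k - 1 by omega) with rfl | h0
    · exact le_rfl
    · exact (hmono l (k - 1) h0 (by omega)).1.le
  rcases lt_or_ge a (g 0) with hag | hga
  · obtain ⟨f', g', hB, hm⟩ := h.exists_chain_of_shifted hleft
      (le_max_left a (f (k - 1))) hk f g
      (fun l hl => ⟨(hfk l hl).trans (le_max_right _ _),
        max_lt (hag.trans_le (hg0 l hl)) (hcross _ (by omega) _ hl)⟩) hmem hmono
    exact ⟨f', g', fun l hl => (hB l hl).1,
      fun l hl l' hl' => (hB l hl).2.1.trans_lt (hB l' hl').2.2, hm⟩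
  · have hmem' : ∀ l < k, B (f (k - 1 - l)) (g (k - 1 - l)) ∨ ∃ m, 1 ≤ m ∧ m ≤ k ∧
        g (k - 1 - l) = J (k - m) ∧ f (k - 1 - l) = I (k - (m - 1)) := fun l hl => by
      rcases hmem (k - 1 - l) (by omega) with b | ⟨m, hm1, hmk, hfl, hgl⟩
      · exact Or.inl b
      · refine Or.inr ⟨k + 1 - m, by omega, by omega, ?_, ?_⟩
        · rw [hgl, show k - (k + 1 - m) = m - 1 by omega]
        · rw [hfl, show k - (k + 1 - m - 1) = m by omega]
    obtain ⟨f', g', hB, hm⟩ := h.dual.exists_chain_of_shifted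
      (fun p q q' b b' hpq hpq' => hright _ _ _ b b' hpq hpq')
      (x := OrderDual.toDual (g 0)) hga hk
      (fun l => OrderDual.toDual (g (k - 1 - l))) (fun l => OrderDual.toDual (f (k - 1 - l)))
      (fun l hl => ⟨hg0 _ (by omega), hcross _ (by omega) _ (by omega)⟩) hmem'
      (fun l l' h₁ h₂ => (hmono (k - 1 - l') (k - 1 - l) (by omega) (by omega)).symm)
    refine ⟨fun l => OrderDual.ofDual (g' (k - 1 - l)),
      fun l => OrderDual.ofDual (f' (k - 1 - l)), fun l hl => (hB _ (by omega)).1,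
      fun l hl l' hl' => ?_, fun l l' h₁ h₂ => ?_⟩
    · exact lt_of_lt_of_le (OrderDual.ofDual_lt_ofDual.mpr (hB (k - 1 - l) (by omega)).2.2)
        (hB (k - 1 - l') (by omega)).2.1
    · exact (hm (k - 1 - l') (k - 1 - l) (by omega) (by omega)).symm

end IsInnermostChain

end Chains

theorem IsBlackArc.isArc {s : Finset ℕ} {P : Finpartition s} {i j : ℕ} (h : IsBlackArc P i j)
    (hij : i < j) : IsArc P i j := h.1.resolve_right fun h => hij.ne h.1

theorem IsArc.right_unique {s : Finset ℕ} {P : Finpartition s} {i j j' : ℕ}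
    (h : IsArc P i j) (h' : IsArc P i j') : j = j' := by
  obtain ⟨hij, b, hb, hib, hjb, hl⟩ := h
  obtain ⟨hij', c, hc, hic, hjc, hl'⟩ := h'
  obtain rfl := P.eq_of_mem_parts hb hc hib hic
  have h₁ := hl j' hjc
  have h₂ := hl' j hjb
  omega

theorem IsArc.left_unique {s : Finset ℕ} {P : Finpartition s} {i i' j : ℕ}
    (h : IsArc P i j) (h' : IsArc P i' j) : i = i' := by
  obtain ⟨hij, b, hb, hib, hjb, hl⟩ := h
  obtain ⟨hij', c, hc, hic, hjc, hl'⟩ := h'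
  obtain rfl := P.eq_of_mem_parts hb hc hjb hjc
  have h₁ := hl i' hic
  have h₂ := hl' i hib
  omega

theorem lexLt_of_le_of_ne {m : ℕ} {u v : Fin m → ℕ} (hle : ∀ i, u i ≤ v i)
    (hne : ∃ i, u i ≠ v i) : LexLt u v := by
  obtain ⟨i, hi, hmin⟩ := WellFounded.has_min (wellFounded_lt (α := Fin m)) {i | u i ≠ v i} hne
  exact ⟨i, fun j hj => by_contra fun h => hmin j h hj, lt_of_le_of_ne (hle i) hi⟩

/-- enhanced left shift creates no black `k`-crossing.
Let `k ≥ 2` and let `P` be a partition of `{0,1,…,n}` whose colored arc diagram has no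
black `k`-crossing. Let `a` be a red node under a black `(k-1)`-crossing, and let
`α = ((i₁,j₁),…,(i_{k-1},j_{k-1}))` be an innermost black `(k-1)`-crossing covering `a`
(its word `(j₁,…,j_{k-1})` is lexicographically smallest among black `(k-1)`-crossings
covering `a`). Then the arc set obtained by replacing the arcs of `α` with the black arcs
`(i₁,a),(i₂,j₁),…,(i_{k-1},j_{k-2}),(a,j_{k-1})` (all other arcs and colors unchanged)
contains no `k` black arcs forming a `k`-crossing. -/
theorem stmt13 (n k : ℕ) (hk : 2 ≤ k) (P : Finpartition (Finset.range (n + 1)))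
    (hP : ¬ SetHasKCrossing (BlackArcSet P) k)
    (a : ℕ) (ha : IsRed P a)
    (α : Fin (k - 1) → ℕ × ℕ)
    (hαmem : ∀ m, α m ∈ BlackArcSet P)
    (hα1 : StrictMono fun m => (α m).1)
    (hα2 : StrictMono fun m => (α m).2)
    (hαcross : ∀ u v : Fin (k - 1), (α u).1 < (α v).2)
    (hunder : ∀ m, (α m).1 < a ∧ a < (α m).2)
    (hinner : ∀ β : Fin (k - 1) → ℕ × ℕ,
      (∀ m, β m ∈ BlackArcSet P) →
      (StrictMono fun m => (β m).1) →
      (StrictMono fun m => (β m).2) →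
      (∀ u v : Fin (k - 1), (β u).1 < (β v).2) →
      (∀ m, (β m).1 < a ∧ a < (β m).2) →
      ¬ LexLt (fun m => (β m).2) (fun m => (α m).2)) :
    ¬ SetHasKCrossing
      ((BlackArcSet P \ Set.range α) ∪
        ({((α ⟨0, by omega⟩).1, a), (a, (α ⟨k - 2, by omega⟩).2)} ∪
          {q | ∃ m m' : Fin (k - 1), (m' : ℕ) + 1 = (m : ℕ) ∧
            q = ((α m).1, (α m').2)})) k := by
  rintro ⟨F, hFmem, hF1, hF2, hFcross⟩
  set I : ℕ → ℕ := fun l => if h : 1 ≤ l ∧ l < k then (α ⟨l - 1, by omega⟩).1 else a with hI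
  set J : ℕ → ℕ := fun l => if h : 1 ≤ l ∧ l < k then (α ⟨l - 1, by omega⟩).2 else a with hJ
  have hIα : ∀ m : Fin (k - 1), I (m + 1) = (α m).1 := fun m => by
    simp only [hI]
    rw [dif_pos ⟨by omega, by omega⟩]
    rfl
  have hJα : ∀ m : Fin (k - 1), J (m + 1) = (α m).2 := fun m => by
    simp only [hJ]
    rw [dif_pos ⟨by omega, by omega⟩]
    rfl
  have hJ0 : J 0 = a := by simp [hJ]
  have hIk : I k = a := by simp [hI]
  have hidx : ∀ l, 1 ≤ l → l < k → ∃ m : Fin (k - 1), (m : ℕ) + 1 = l := fun l h₁ h₂ =>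
    ⟨⟨l - 1, by omega⟩, by simp; omega⟩
  have hchain : IsInnermostChain k (IsBlackArc P) a I J := by
    refine ⟨hJ0, hIk, fun l l' h₁ h₂ h₃ => ?_, fun l l' h₁ h₂ => ?_, fun l h₁ h₂ => ?_,
      fun i j hij hm l h₁ h₂ hlt => ?_⟩
    · obtain ⟨m, rfl⟩ := hidx l h₁ (by omega)
      rcases eq_or_lt_of_le h₃ with rfl | h₃
      · rw [hIα, hIk]
        exact (hunder m).1
      · obtain ⟨m', rfl⟩ := hidx l' (by omega) h₃
        rw [hIα, hIα]
        exact hα1 (Fin.lt_def.mpr (by omega))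
    · obtain ⟨m', rfl⟩ := hidx l' (by omega) h₂
      rcases Nat.eq_zero_or_pos l with rfl | h0
      · rw [hJα, hJ0]
        exact (hunder m').2
      · obtain ⟨m, rfl⟩ := hidx l h0 (by omega)
        rw [hJα, hJα]
        exact hα2 (Fin.lt_def.mpr (by omega))
    · obtain ⟨m, rfl⟩ := hidx l h₁ h₂
      rw [hIα, hJα]
      exact hαmem m
    · have hij' := fun m : Fin (k - 1) => hij (m + 1) (by omega) (by omega)
      refine hinner (fun m => (i (m + 1), j (m + 1))) (fun m => (hij' m).1)
        (fun m m' hmm => (hm _ _ (by omega) (Nat.succ_lt_succ hmm) (by omega)).1)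
        (fun m m' hmm => (hm _ _ (by omega) (Nat.succ_lt_succ hmm) (by omega)).2)
        (fun u v => (hij' u).2.2.1.trans (hij' v).2.2.2.1)
        (fun m => ⟨(hij' m).2.2.1, (hij' m).2.2.2.1⟩) (lexLt_of_le_of_ne (fun m => ?_) ?_)
      · rw [← hJα]
        exact (hij' m).2.2.2.2
      · obtain ⟨m, rfl⟩ := hidx l h₁ h₂
        exact ⟨m, by rw [← hJα]; exact hlt.2.ne⟩
  set f : ℕ → ℕ := fun l => if h : l < k then (F ⟨l, h⟩).1 else 0
  set g : ℕ → ℕ := fun l => if h : l < k then (F ⟨l, h⟩).2 else 0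
  have hfF : ∀ l (h : l < k), f l = (F ⟨l, h⟩).1 := fun l h => dif_pos h
  have hgF : ∀ l (h : l < k), g l = (F ⟨l, h⟩).2 := fun l h => dif_pos h
  obtain ⟨f', g', hB, hcross, hmono⟩ := hchain.exists_crossing_of_shifted
    (fun p q q' b b' h h' => (b.isArc h).right_unique (b'.isArc h'))
    (fun p p' q b b' h h' => (b.isArc h).left_unique (b'.isArc h'))
    (by omega) f g
    (fun l hl l' hl' => by
      rw [hfF l hl, hgF l' hl']
      exact hFcross _ _)
    (fun l hl => by
      rw [hfF l hl, hgF l hl]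
      rcases hFmem ⟨l, hl⟩ with hold | (hnew | hnew) | ⟨m, m', hmm, hnew⟩
      · exact Or.inl hold.1
      · refine Or.inr ⟨1, le_rfl, by omega, ?_, ?_⟩
        · rw [hnew]
          exact (hIα ⟨0, by omega⟩).symm
        · rw [hnew]
          exact hJ0.symm
      · rw [Set.mem_singleton_iff] at hnew
        refine Or.inr ⟨k, by omega, le_rfl, ?_, ?_⟩
        · rw [hnew, hIk]
        · rw [hnew, ← hJα]
          congr 1
          simp only
          omega
      · refine Or.inr ⟨m + 1, by omega, by omega, ?_, ?_⟩
        · rw [hnew, hIα]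
        · rw [hnew, Nat.add_sub_cancel, ← hmm, hJα])
    (fun l l' h₁ h₂ => by
      rw [hfF l (h₁.trans h₂), hgF l (h₁.trans h₂), hfF l' h₂, hgF l' h₂]
      exact ⟨hF1 (Fin.mk_lt_mk.mpr h₁), hF2 (Fin.mk_lt_mk.mpr h₁)⟩)
  exact hP ⟨fun m => (f' m, g' m), fun m => hB m m.2,
    fun u v huv => (hmono u v huv v.2).1, fun u v huv => (hmono u v huv v.2).2,
    fun u v => hcross u u.2 v v.2⟩
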